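/- Aggregation of the first two coordinates at the level of measures: let n ≥ 2, α : Fin n → ℕ with α i ≥ 1 for all i, and let h : Fin n → Fin (n−1) be the surjection with h(1) = h(2) = 1 and h(i+2) = i+1, so M(h)(α) = (α₁+α₂, α₃, …, α_n). Then for every measurable subset N ⊆ Δ°_{n−1}, ∫_{x ∈ N} d_{n−1}(M(h)(α))(x) dx = ∫_{y ∈ D(h)⁻¹(N)} d_n(α)(y) dy, where D(h) : Δ°_n → Δ°_{n−1} sends y to the point j ↦ ∑_{i : h i = j} y i. -/

import Mathlib

open MeasureTheory Finset

noncomputable section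

/-- The open simplex `Δ°_n = {x : Fin n → ℝ | (∀ i, 0 < x i) ∧ ∑ i, x i = 1}`. -/
def openSimplex (n : ℕ) : Set (Fin n → ℝ) := {x | (∀ i, 0 < x i) ∧ ∑ i, x i = 1}

/-- The open parameter domain for `Δ°_{m+1}`: the first `m` coordinates are
positive with sum `< 1`. -/
def simplexDomain (m : ℕ) : Set (Fin m → ℝ) := {y | (∀ i, 0 < y i) ∧ ∑ i, y i < 1}

/-- Parametrize the simplex `Δ°_{m+1}`: the last coordinate is `1 - ∑` of the others. -/
def toSimplex (m : ℕ) (y : Fin m → ℝ) : Fin (m + 1) → ℝ :=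
  Fin.snoc y (1 - ∑ i, y i)

/-- The `m`-dimensional Lebesgue measure on the open simplex `Δ°_{m+1}`, obtained by
pushing forward Lebesgue measure on the open parameter domain along the
parametrization in which the last coordinate is `1 - ∑` of the first `m`. -/
def simplexMeasure (m : ℕ) : Measure (Fin (m + 1) → ℝ) :=
  Measure.map (toSimplex m) (volume.restrict (simplexDomain m))

/-- The Dirichlet density `d(α)(x) = (Γ(∑ i, α i) / ∏ i, Γ(α i)) · ∏ i, (x i)^(α i − 1)`
with natural-number hyperparameters `α`. -/
def dirDensity {X : Type*} [Fintype X] (α : X → ℕ) (x : X → ℝ) : ℝ :=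
  (Real.Gamma (∑ i, (α i : ℝ)) / ∏ i, Real.Gamma (α i : ℝ)) * ∏ i, x i ^ (α i - 1)

/-- The Dirichlet distribution `Dir(α)` on `Δ°_{m+1}`, i.e. the measure with
density `d(α)` with respect to Lebesgue measure on the simplex. -/
def Dir (m : ℕ) (α : Fin (m + 1) → ℕ) : Measure (Fin (m + 1) → ℝ) :=
  (simplexMeasure m).withDensity fun x => ENNReal.ofReal (dirDensity α x)

/-- Pushforward of a multiset along `h`: `M(h)(α)(j) = ∑_{i : h i = j} α i`. -/
def mPush {n m : ℕ} (h : Fin n → Fin m) (α : Fin n → ℕ) : Fin m → ℕ :=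
  fun j => ∑ i ∈ Finset.univ.filter (fun i => h i = j), α i

/-- Pushforward of a point of the simplex along `h`: `D(h)(y)(j) = ∑_{i : h i = j} y i`. -/
def dPush {n m : ℕ} (h : Fin n → Fin m) (y : Fin n → ℝ) : Fin m → ℝ :=
  fun j => ∑ i ∈ Finset.univ.filter (fun i => h i = j), y i

/-- The surjection `Fin (m+2) → Fin (m+1)` merging the first two indices:
`h 0 = h 1 = 0` and `h (i+2) = i+1` (the paper's 1-based `h(1) = h(2) = 1`,
`h(i+2) = i+1`). -/
def aggMap (m : ℕ) : Fin (m + 2) → Fin (m + 1)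
  | ⟨0, _⟩ => 0
  | ⟨1, _⟩ => 0
  | ⟨i + 2, h⟩ => ⟨i + 1, by omega⟩

/-- Split the first coordinate of `x` into the pair `(t, x 0 - t)`. -/
def splitFirst {m : ℕ} (x : Fin (m + 1) → ℝ) (t : ℝ) : Fin (m + 2) → ℝ :=
  Fin.cons t (x - Pi.single 0 t)

@[simp]
lemma splitFirst_zero {m : ℕ} (x : Fin (m + 1) → ℝ) (t : ℝ) : splitFirst x t 0 = t := rfl

@[simp]
lemma splitFirst_succ_zero {m : ℕ} (x : Fin (m + 1) → ℝ) (t : ℝ) :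
    splitFirst x t (Fin.succ 0) = x 0 - t := by
  simp only [splitFirst, Fin.cons_succ, Pi.sub_apply, Pi.single_eq_same]

@[simp]
lemma splitFirst_succ_succ {m : ℕ} (x : Fin (m + 1) → ℝ) (t : ℝ) (i : Fin m) :
    splitFirst x t i.succ.succ = x i.succ := by
  simp [splitFirst]

lemma measurable_splitFirst (m : ℕ) :
    Measurable fun p : (Fin (m + 1) → ℝ) × ℝ => splitFirst p.1 p.2 := by
  refine measurable_pi_lambda _ fun i => ?_
  refine Fin.cases ?_ (fun i => Fin.cases ?_ (fun i => ?_) i) i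
  · simp only [splitFirst_zero]; fun_prop
  · simp only [splitFirst_succ_zero]; fun_prop
  · simp only [splitFirst_succ_succ]; fun_prop

lemma measurable_toSimplex (m : ℕ) : Measurable (toSimplex m) := by
  refine measurable_pi_lambda _ fun i => ?_
  refine Fin.lastCases ?_ (fun i => ?_) i
  · simp only [toSimplex, Fin.snoc_last]; fun_prop
  · simp only [toSimplex, Fin.snoc_castSucc]; fun_prop

lemma measurableSet_simplexDomain (m : ℕ) : MeasurableSet (simplexDomain m) := by
  refine MeasurableSet.inter (s₁ := {y : Fin m → ℝ | ∀ i, 0 < y i}) ?_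
    (measurableSet_lt (f := fun y : Fin m → ℝ => ∑ i, y i) (by fun_prop) measurable_const)
  simp only [Set.ofPred_forall]
  exact MeasurableSet.iInter fun i => measurableSet_lt measurable_const (measurable_pi_apply i)

lemma toSimplex_pos_iff {m : ℕ} {y : Fin m → ℝ} :
    (∀ i, 0 < toSimplex m y i) ↔ y ∈ simplexDomain m := by
  simp [Fin.forall_fin_succ', toSimplex, simplexDomain]

lemma toSimplex_cons_sub {m : ℕ} (x : Fin m → ℝ) (t : ℝ) :
    toSimplex (m + 1)
        (Fin.cons t (x - Fin.init (α := fun _ => ℝ) (Pi.single 0 t)))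
      = splitFirst (toSimplex m x) t := by
  have hsum : ∑ i, (Pi.single 0 t : Fin (m + 1) → ℝ) i = t := by simp
  rw [Fin.sum_univ_castSucc] at hsum
  unfold toSimplex splitFirst
  rw [← Fin.cons_snoc_eq_snoc_cons]
  congr 1
  ext i
  refine Fin.lastCases ?_ (fun i => ?_) i
  · simp only [Fin.snoc_last, Pi.sub_apply, Fin.sum_cons, Finset.sum_sub_distrib, Fin.init]
    linarith
  · simp [Fin.init]

lemma splitFirst_pos_iff {m : ℕ} {x : Fin (m + 1) → ℝ} {t : ℝ} :
    (∀ i, 0 < splitFirst x t i) ↔ (∀ i, 0 < x i) ∧ t ∈ Set.Ioo 0 (x 0) := by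
  rw [Fin.forall_fin_succ, Fin.forall_fin_succ, Fin.forall_fin_succ (P := fun i => 0 < x i)]
  simp only [splitFirst_zero, splitFirst_succ_zero, splitFirst_succ_succ, Set.mem_Ioo, sub_pos]
  constructor
  · rintro ⟨h₁, h₂, h₃⟩
    exact ⟨⟨h₁.trans h₂, h₃⟩, h₁, h₂⟩
  · rintro ⟨⟨-, h₃⟩, h₁, h₂⟩
    exact ⟨h₁, h₂, h₃⟩

/-- Integration over the simplex by splitting the first coordinate of a point of the simplex of
one dimension less. -/
lemma lintegral_simplexMeasure_succ (m : ℕ) {g : (Fin (m + 2) → ℝ) → ENNReal}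
    (hg : Measurable g) :
    ∫⁻ y, g y ∂simplexMeasure (m + 1)
      = ∫⁻ x, (∫⁻ t in Set.Ioo 0 (x 0), g (splitFirst x t)) ∂simplexMeasure m := by
  set F : (Fin (m + 1) → ℝ) → ENNReal :=
    (simplexDomain (m + 1)).indicator fun z => g (toSimplex (m + 1) z) with hF
  have hFm : Measurable F :=
    (hg.comp (measurable_toSimplex _)).indicator (measurableSet_simplexDomain _)
  have hcons : Measurable fun p : ℝ × (Fin m → ℝ) => (Fin.cons p.1 p.2 : Fin (m + 1) → ℝ) := by
    refine measurable_pi_lambda _ fun i => ?_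
    refine Fin.cases ?_ (fun i => ?_) i
    · simp only [Fin.cons_zero]; fun_prop
    · simp only [Fin.cons_succ]; fun_prop
  have hshift : Measurable fun p : ℝ × (Fin m → ℝ) =>
      (p.2 - Fin.init (α := fun _ => ℝ) (Pi.single 0 p.1) : Fin m → ℝ) := by
    refine measurable_pi_lambda _ fun i => ?_
    simp only [Pi.sub_apply, Fin.init, Pi.single_apply]
    split_ifs <;> fun_prop
  have hset : MeasurableSet {p : (Fin (m + 1) → ℝ) × ℝ | p.2 ∈ Set.Ioo 0 (p.1 0)} :=
    (measurableSet_lt measurable_const measurable_snd).inter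
      (measurableSet_lt measurable_snd ((measurable_pi_apply 0).comp measurable_fst))
  have hG : Measurable fun x : Fin (m + 1) → ℝ =>
      ∫⁻ t in Set.Ioo 0 (x 0), g (splitFirst x t) := by
    simp_rw [← lintegral_indicator measurableSet_Ioo]
    exact ((hg.comp (measurable_splitFirst m)).indicator hset).lintegral_prod_right'
  calc ∫⁻ y, g y ∂simplexMeasure (m + 1)
      = ∫⁻ z, F z := by
        rw [simplexMeasure, lintegral_map hg (measurable_toSimplex _),
          ← lintegral_indicator (measurableSet_simplexDomain _)]
    _ = ∫⁻ p : ℝ × (Fin m → ℝ), F (Fin.cons p.1 p.2) := by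
        rw [← (volume_preserving_piFinSuccAbove (fun _ : Fin (m + 1) => ℝ) 0).symm.lintegral_comp
          hFm]
        simp [MeasurableEquiv.piFinSuccAbove, Fin.insertNthEquiv]
    _ = ∫⁻ t, ∫⁻ w : Fin m → ℝ, F (Fin.cons t w) :=
        lintegral_prod _ (hFm.comp hcons).aemeasurable
    _ = ∫⁻ t, ∫⁻ x : Fin m → ℝ,
          F (Fin.cons t (x - Fin.init (α := fun _ => ℝ) (Pi.single 0 t))) := by
        refine lintegral_congr fun t => ?_
        rw [lintegral_sub_right_eq_self (fun w : Fin m → ℝ => F (Fin.cons t w))]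
    _ = ∫⁻ x : Fin m → ℝ, ∫⁻ t,
          F (Fin.cons t (x - Fin.init (α := fun _ => ℝ) (Pi.single 0 t))) := by
        refine lintegral_lintegral_swap (Measurable.aemeasurable ?_)
        exact hFm.comp (hcons.comp (measurable_fst.prodMk hshift))
    _ = ∫⁻ x in simplexDomain m, ∫⁻ t in Set.Ioo 0 (toSimplex m x 0),
          g (splitFirst (toSimplex m x) t) := by
        rw [← lintegral_indicator (measurableSet_simplexDomain _)]
        refine lintegral_congr fun x => ?_
        have key (t : ℝ) : F (Fin.cons t (x - Fin.init (α := fun _ => ℝ) (Pi.single 0 t)))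
            = (simplexDomain m).indicator (fun x => (Set.Ioo 0 (toSimplex m x 0)).indicator
                (fun t => g (splitFirst (toSimplex m x) t)) t) x := by
          classical
          rw [hF, Set.indicator_apply, Set.indicator_apply, Set.indicator_apply]
          simp only [← toSimplex_pos_iff, toSimplex_cons_sub, splitFirst_pos_iff, ite_and]
        simp_rw [key]
        by_cases hx : x ∈ simplexDomain m
        · simp only [Set.indicator_of_mem hx]
          rw [lintegral_indicator measurableSet_Ioo]
        · simp [Set.indicator_of_notMem hx]
    _ = _ := by rw [simplexMeasure, lintegral_map hG (measurable_toSimplex _)]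

lemma ae_simplexMeasure_pos (m : ℕ) : ∀ᵐ x ∂simplexMeasure m, ∀ i, 0 < x i := by
  have hset : MeasurableSet {x : Fin (m + 1) → ℝ | ∀ i, 0 < x i} := by
    simp only [Set.ofPred_forall]
    exact MeasurableSet.iInter fun i => measurableSet_lt measurable_const (measurable_pi_apply i)
  rw [simplexMeasure, ae_map_iff (measurable_toSimplex m).aemeasurable hset]
  filter_upwards [ae_restrict_mem (measurableSet_simplexDomain m)] with y hy
  exact toSimplex_pos_iff.2 hy

/-- The Beta integral over `(0, x)` for natural exponents. -/
lemma integral_pow_mul_sub_pow (a b : ℕ) {x : ℝ} (hx : 0 < x) :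
    ∫ t in (0 : ℝ)..x, t ^ a * (x - t) ^ b
      = x ^ (a + b + 1) * (Real.Gamma (a + 1) * Real.Gamma (b + 1)
          / Real.Gamma ((a + 1) + (b + 1))) := by
  have h := Complex.betaIntegral_scaled (a + 1) (b + 1) hx
  rw [Complex.betaIntegral_eq_Gamma_mul_div _ _ (by simp; positivity) (by simp; positivity),
    show (a + 1 + (b + 1) - 1 : ℂ) = ((a + b + 1 : ℕ) : ℂ) by push_cast; ring] at h
  simp only [add_sub_cancel_right, Complex.cpow_natCast] at h
  apply Complex.ofReal_injective
  rw [← intervalIntegral.integral_ofReal]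
  push_cast [← Complex.Gamma_ofReal]
  exact h

lemma setLIntegral_pow_mul_sub_pow (a b : ℕ) {x : ℝ} (hx : 0 < x) :
    ∫⁻ t in Set.Ioo 0 x, ENNReal.ofReal (t ^ a * (x - t) ^ b)
      = ENNReal.ofReal (x ^ (a + b + 1) * (Real.Gamma (a + 1) * Real.Gamma (b + 1)
          / Real.Gamma ((a + 1) + (b + 1)))) := by
  rw [← integral_pow_mul_sub_pow a b hx, intervalIntegral.integral_of_le hx.le,
    integral_Ioc_eq_integral_Ioo, ofReal_integral_eq_lintegral_ofReal]
  · have hc : Continuous fun t : ℝ => t ^ a * (x - t) ^ b := by fun_prop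
    exact (hc.integrableOn_Icc (a := 0) (b := x)).mono_set Set.Ioo_subset_Icc_self
  · filter_upwards [ae_restrict_mem measurableSet_Ioo] with t ht
    exact mul_nonneg (pow_nonneg ht.1.le _) (pow_nonneg (sub_nonneg.2 ht.2.le) _)

lemma continuous_dirDensity {X : Type*} [Fintype X] (α : X → ℕ) : Continuous (dirDensity α) := by
  unfold dirDensity; fun_prop

lemma dirDensity_nonneg {X : Type*} [Fintype X] (α : X → ℕ) {x : X → ℝ} (hx : ∀ i, 0 < x i) :
    0 ≤ dirDensity α x := by
  have h (i : X) : 0 ≤ x i := (hx i).le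
  unfold dirDensity
  have h₁ : 0 ≤ Real.Gamma (∑ i, (α i : ℝ)) := Real.Gamma_nonneg_of_nonneg (by positivity)
  have h₂ : 0 ≤ ∏ i, Real.Gamma (α i : ℝ) :=
    prod_nonneg fun i _ => Real.Gamma_nonneg_of_nonneg (by positivity)
  have h₃ : 0 ≤ ∏ i, x i ^ (α i - 1) := prod_nonneg fun i _ => pow_nonneg (h i) _
  positivity

lemma sum_filter_aggMap_zero {M : Type*} [AddCommMonoid M] (m : ℕ) (f : Fin (m + 2) → M) :
    ∑ i ∈ univ.filter (fun i => aggMap m i = 0), f i = f 0 + f 1 := by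
  rw [sum_filter, Fin.sum_univ_succ, Fin.sum_univ_succ, sum_eq_zero, if_pos, if_pos]
  · simp
  · rfl
  · rfl
  · exact fun i _ => if_neg (Fin.succ_ne_zero i)

lemma sum_filter_aggMap_succ {M : Type*} [AddCommMonoid M] (m : ℕ) (f : Fin (m + 2) → M)
    (j : Fin m) :
    ∑ i ∈ univ.filter (fun i => aggMap m i = j.succ), f i = f j.succ.succ := by
  have h₀ : aggMap m 0 ≠ j.succ := (Fin.succ_ne_zero j).symm
  have h₁ : aggMap m (Fin.succ 0) ≠ j.succ := (Fin.succ_ne_zero j).symm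
  rw [sum_filter, Fin.sum_univ_succ, Fin.sum_univ_succ, if_neg h₀, if_neg h₁, zero_add, zero_add,
    sum_eq_single j, if_pos]
  · rfl
  · exact fun i _ hij => if_neg fun h => hij (Fin.succ_injective _ h)
  · simp

lemma dPush_aggMap_splitFirst {m : ℕ} (x : Fin (m + 1) → ℝ) (t : ℝ) :
    dPush (aggMap m) (splitFirst x t) = x := by
  ext j
  refine Fin.cases ?_ (fun j => ?_) j
  · simp only [dPush, sum_filter_aggMap_zero]
    rw [← Fin.succ_zero_eq_one, splitFirst_zero, splitFirst_succ_zero]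
    ring
  · simp only [dPush, sum_filter_aggMap_succ, splitFirst_succ_succ]

lemma measurable_dPush {n m : ℕ} (h : Fin n → Fin m) : Measurable (dPush h) := by
  unfold dPush; fun_prop

/-- Integrating the Dirichlet density along the fibres of the aggregation map. -/
lemma setLIntegral_dirDensity_splitFirst {m : ℕ} {α : Fin (m + 2) → ℕ} (hα : ∀ i, 1 ≤ α i)
    {x : Fin (m + 1) → ℝ} (hx : ∀ i, 0 < x i) :
    ∫⁻ t in Set.Ioo 0 (x 0), ENNReal.ofReal (dirDensity α (splitFirst x t))
      = ENNReal.ofReal (dirDensity (mPush (aggMap m) α) x) := by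
  obtain ⟨β, rfl⟩ : ∃ β : Fin (m + 2) → ℕ, α = fun i => β i + 1 :=
    ⟨fun i => α i - 1, funext fun i => (Nat.sub_add_cancel (hα i)).symm⟩
  set C : ℝ := Real.Gamma (∑ i, ((β i + 1 : ℕ) : ℝ)) / (∏ i, Real.Gamma ((β i + 1 : ℕ) : ℝ)) *
    ∏ i : Fin m, x i.succ ^ β i.succ.succ with hC
  have hC₀ : 0 ≤ C := by
    have h₁ : 0 ≤ Real.Gamma (∑ i, ((β i + 1 : ℕ) : ℝ)) :=
      Real.Gamma_nonneg_of_nonneg (by positivity)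
    have h₂ : 0 ≤ ∏ i, Real.Gamma ((β i + 1 : ℕ) : ℝ) :=
      prod_nonneg fun i _ => Real.Gamma_nonneg_of_nonneg (by positivity)
    have h₃ : 0 ≤ ∏ i : Fin m, x i.succ ^ β i.succ.succ :=
      prod_nonneg fun i _ => pow_nonneg (hx _).le _
    positivity
  have hsplit (t : ℝ) : dirDensity (fun i => β i + 1) (splitFirst x t)
      = C * (t ^ β 0 * (x 0 - t) ^ β (Fin.succ 0)) := by
    have hprod : ∏ i, splitFirst x t i ^ (β i + 1 - 1) = splitFirst x t 0 ^ (β 0 + 1 - 1) *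
        (splitFirst x t (Fin.succ 0) ^ (β (Fin.succ 0) + 1 - 1) *
          ∏ i : Fin m, splitFirst x t i.succ.succ ^ (β i.succ.succ + 1 - 1)) := by
      rw [Fin.prod_univ_succ, Fin.prod_univ_succ]
    rw [dirDensity, hprod]
    simp only [splitFirst_zero, splitFirst_succ_zero, splitFirst_succ_succ, add_tsub_cancel_right,
      hC]
    ring
  simp_rw [hsplit, ENNReal.ofReal_mul hC₀]
  rw [lintegral_const_mul' _ _ ENNReal.ofReal_ne_top, setLIntegral_pow_mul_sub_pow _ _ (hx 0),
    ← ENNReal.ofReal_mul hC₀]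
  congr 1
  have h₀ : mPush (aggMap m) (fun i => β i + 1) 0 = (β 0 + 1) + (β (Fin.succ 0) + 1) :=
    sum_filter_aggMap_zero m _
  have h_succ (j : Fin m) :
      mPush (aggMap m) (fun i => β i + 1) j.succ = β j.succ.succ + 1 :=
    sum_filter_aggMap_succ m _ j
  have hΓ (k : ℕ) : Real.Gamma ((k : ℝ) + 1) ≠ 0 := (Real.Gamma_pos_of_pos (by positivity)).ne'
  have hΓ' : Real.Gamma ((β 0 : ℝ) + 1 + (β (Fin.succ 0) + 1)) ≠ 0 :=
    (Real.Gamma_pos_of_pos (by positivity)).ne'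
  have hP : ∏ j : Fin m, Real.Gamma ((β j.succ.succ : ℝ) + 1) ≠ 0 :=
    prod_ne_zero_iff.2 fun j _ => hΓ _
  rw [dirDensity, hC, Fin.sum_univ_succ, Fin.sum_univ_succ, Fin.prod_univ_succ,
    Fin.prod_univ_succ, Fin.sum_univ_succ (n := m), Fin.prod_univ_succ (n := m),
    Fin.prod_univ_succ (n := m)]
  simp only [h₀, h_succ, Nat.cast_add, Nat.cast_one, add_tsub_cancel_right,
    ← add_assoc] at hΓ' ⊢
  have h₁ := hΓ (β 0)
  have h₂ := hΓ (β (Fin.succ 0))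
  rw [add_right_comm (β 0) 1]
  field_simp

/-- **Aggregation of the first two coordinates at the level of measures.**
Let `n = m + 2 ≥ 2`, `α : Fin n → ℕ` with `α i ≥ 1` for all `i`, and let
`h = aggMap m`, so `M(h)(α) = (α₁+α₂, α₃, …, α_n)`. Then for every measurable
`N ⊆ Δ°_{n−1}`,
`∫_{x ∈ N} d_{n−1}(M(h)(α))(x) dx = ∫_{y ∈ D(h)⁻¹(N)} d_n(α)(y) dy`. -/
theorem dirichlet_aggregation_measure (m : ℕ) (α : Fin (m + 2) → ℕ)
    (hα : ∀ i, 1 ≤ α i) (N : Set (Fin (m + 1) → ℝ)) (hN : MeasurableSet N)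
    (hNs : N ⊆ openSimplex (m + 1)) :
    ∫ x in N, dirDensity (mPush (aggMap m) α) x ∂simplexMeasure m
      = ∫ y in dPush (aggMap m) ⁻¹' N, dirDensity α y ∂simplexMeasure (m + 1) := by
  have hpre : MeasurableSet (dPush (aggMap m) ⁻¹' N) := measurable_dPush _ hN
  rw [integral_eq_lintegral_of_nonneg_ae
      (ae_restrict_of_ae ((ae_simplexMeasure_pos m).mono fun x hx => dirDensity_nonneg _ hx))
      (continuous_dirDensity _).aestronglyMeasurable,
    integral_eq_lintegral_of_nonneg_ae
      (ae_restrict_of_ae ((ae_simplexMeasure_pos (m + 1)).mono fun x hx => dirDensity_nonneg _ hx))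
      (continuous_dirDensity _).aestronglyMeasurable,
    ← lintegral_indicator hN, ← lintegral_indicator hpre,
    lintegral_simplexMeasure_succ m
      ((continuous_dirDensity α).measurable.ennreal_ofReal.indicator hpre)]
  congr 1
  classical
  refine lintegral_congr fun x => ?_
  simp only [Set.indicator_apply, Set.mem_preimage, dPush_aggMap_splitFirst]
  by_cases hx : x ∈ N
  · simp only [if_pos hx, setLIntegral_dirDensity_splitFirst hα (hNs hx).1]
  · simp [hx]
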